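/- Let $p>1$, $K$ a compact metric space, $(X,\sigma)$ a finite measure space, $F$ a real Banach space, and let $E$ be a closed subspace of $C(K)$ containing the constant function $1$. If $T$ is a linear isometry from $E$ into the Lebesgue–Bochner space $L_p(X;F)$, then there exist a measurable function $h:X\to\mathbb{R}$ and a mapping $U:X\to I(E,F)$ into the set of linear isometries from $E$ to $F$, strongly measurable in the sense that $x\mapsto U(x)e$ is strongly measurable for each $e\in E$, such that for every $e\in E$, $Te(x)=h(x)\,U(x)e$ for $\sigma$-almost all $x\in X$. -/

import Mathlib

open MeasureTheory Filter Topology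

/-- If `‖a‖ = ‖b‖ = 1` and `‖a + b‖ = 2` in a Lebesgue–Bochner space with `1 < p < ∞`, then `a` and
`b` have the same pointwise norm almost everywhere. -/
theorem ae_norm_eq_of_norm_add_eq_two {F : Type*} [NormedAddCommGroup F]
    {X : Type*} [MeasurableSpace X] {σ : Measure X} {p : ℝ} (hp : 1 < p)
    (a b : Lp F (ENNReal.ofReal p) σ) (ha : ‖a‖ = 1) (hb : ‖b‖ = 1) (hab : ‖a + b‖ = 2) :
    ∀ᵐ x ∂σ, ‖a x‖ = ‖b x‖ := by
  have hp0 : 0 < p := by linarith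
  have hq0 : ENNReal.ofReal p ≠ 0 := by simpa using hp0
  have hqt : ENNReal.ofReal p ≠ ⊤ := ENNReal.ofReal_ne_top
  have hpr : (ENNReal.ofReal p).toReal = p := ENNReal.toReal_ofReal hp0.le
  have hnorm (f : Lp F (ENNReal.ofReal p) σ) : ‖f‖ ^ p = ∫ x, ‖f x‖ ^ p ∂σ := by
    have hnn : 0 ≤ ∫ x, ‖f x‖ ^ p ∂σ := integral_nonneg fun x => by positivity
    rw [Lp.norm_def, (Lp.memLp f).eLpNorm_eq_integral_rpow_norm hq0 hqt, hpr,
      ENNReal.toReal_ofReal (by positivity), Real.rpow_inv_rpow hnn hp0.ne']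
  have hint (f : Lp F (ENNReal.ofReal p) σ) : Integrable (fun x => ‖f x‖ ^ p) σ := by
    simpa only [hpr] using (Lp.memLp f).integrable_norm_rpow hq0 hqt
  have hconv := strictConvexOn_rpow hp
  have hle (s t : ℝ) (hs : 0 ≤ s) (ht : 0 ≤ t) :
      ((s + t) / 2) ^ p ≤ (s ^ p + t ^ p) / 2 := by
    have := hconv.convexOn.2 hs ht (one_half_pos (α := ℝ)).le one_half_pos.le (add_halves 1)
    simp only [smul_eq_mul] at this
    calc ((s + t) / 2) ^ p = (1 / 2 * s + 1 / 2 * t) ^ p := by ring_nf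
      _ ≤ _ := this
      _ = _ := by ring
  have hmid : ∀ᵐ x ∂σ, (‖(a + b : Lp F (ENNReal.ofReal p) σ) x‖ / 2) ^ p
      ≤ ((‖a x‖ + ‖b x‖) / 2) ^ p := by
    filter_upwards [Lp.coeFn_add a b] with x hx
    rw [hx]
    exact Real.rpow_le_rpow (by positivity)
      (div_le_div_of_nonneg_right (norm_add_le _ _) zero_le_two) hp0.le
  have hl : ∫ x, (‖(a + b : Lp F (ENNReal.ofReal p) σ) x‖ / 2) ^ p ∂σ = 1 := by
    simp_rw [Real.div_rpow (norm_nonneg _) zero_le_two]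
    rw [integral_div, ← hnorm, hab, div_self (by positivity)]
  have hr : ∫ x, (‖a x‖ ^ p + ‖b x‖ ^ p) / 2 ∂σ = 1 := by
    rw [integral_div, integral_add (hint a) (hint b), ← hnorm, ← hnorm, ha, hb]
    norm_num
  have hli : Integrable (fun x => (‖(a + b : Lp F (ENNReal.ofReal p) σ) x‖ / 2) ^ p) σ := by
    simp_rw [Real.div_rpow (norm_nonneg _) zero_le_two]
    exact (hint _).div_const _
  have hri : Integrable (fun x => (‖a x‖ ^ p + ‖b x‖ ^ p) / 2) σ :=
    ((hint a).add (hint b)).div_const _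
  have hae := (integral_eq_iff_of_ae_le hli hri (by
    filter_upwards [hmid] with x hx
    exact hx.trans (hle _ _ (norm_nonneg _) (norm_nonneg _)))).1 (hl.trans hr.symm)
  filter_upwards [hae, hmid] with x hx hx'
  by_contra hne
  have := hconv.2 (norm_nonneg (a x)) (norm_nonneg (b x)) hne
    (one_half_pos (α := ℝ)) one_half_pos (add_halves 1)
  simp only [smul_eq_mul] at this
  have h2 : ((‖a x‖ + ‖b x‖) / 2) ^ p < (‖a x‖ ^ p + ‖b x‖ ^ p) / 2 :=
    calc ((‖a x‖ + ‖b x‖) / 2) ^ p = (1 / 2 * ‖a x‖ + 1 / 2 * ‖b x‖) ^ p := by ring_nf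
      _ < _ := this
      _ = _ := by ring
  exact (hx'.trans_lt h2).ne hx

/-- A continuous function of norm one satisfies `‖1 + f‖ = 2` or `‖1 - f‖ = 2`. -/
theorem norm_one_add_eq_two_or_norm_one_sub_eq_two {K : Type*} [TopologicalSpace K]
    [CompactSpace K] (f : C(K, ℝ)) (hf : ‖f‖ = 1) : ‖1 + f‖ = 2 ∨ ‖1 - f‖ = 2 := by
  have hK : Nonempty K := by
    by_contra h
    rw [not_nonempty_iff] at h
    have : f = 0 := Subsingleton.elim _ _
    simp [this] at hf
  have h1 : ‖(1 : C(K, ℝ))‖ = 1 := norm_one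
  obtain ⟨t, ht⟩ : ∃ t, ‖f t‖ = 1 := by
    obtain ⟨t, -, ht⟩ := isCompact_univ.exists_isMaxOn Set.univ_nonempty
      (f := fun t => ‖f t‖) (by fun_prop)
    refine ⟨t, le_antisymm (hf ▸ f.norm_coe_le_norm t) ?_⟩
    rw [← hf]
    exact (ContinuousMap.norm_le _ (norm_nonneg _)).2 fun x => ht (Set.mem_univ x)
  rw [Real.norm_eq_abs] at ht
  rcases abs_cases (f t) with h | h
  · refine .inl (le_antisymm ?_ ?_)
    · linarith [norm_add_le 1 f]
    · have := (1 + f).norm_coe_le_norm t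
      rw [Real.norm_eq_abs] at this
      simp only [ContinuousMap.add_apply, ContinuousMap.one_apply] at this
      linarith [le_abs_self (1 + f t)]
  · refine .inr (le_antisymm ?_ ?_)
    · linarith [norm_sub_le 1 f]
    · have := (1 - f).norm_coe_le_norm t
      rw [Real.norm_eq_abs] at this
      simp only [ContinuousMap.sub_apply, ContinuousMap.one_apply] at this
      linarith [le_abs_self (1 - f t)]

/-- A norm-preserving additive map on a dense additive subgroup extends to a linear isometry. -/
theorem AddSubgroup.exists_linearIsometry_extension {E F : Type*}
    [NormedAddCommGroup E] [NormedSpace ℝ E]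
    [NormedAddCommGroup F] [NormedSpace ℝ F] [CompleteSpace F]
    (G : AddSubgroup E) (hG : Dense (G : Set E)) (f : G →+ F) (hf : ∀ a, ‖f a‖ = ‖a‖) :
    ∃ V : E →ₗᵢ[ℝ] F, ∀ a : G, V a = f a := by
  have hfc : Continuous f :=
    (AddMonoidHomClass.isometry_of_norm f hf).continuous
  let f' : G →L[ℤ] F := ⟨f.toIntLinearMap, hfc⟩
  let i : G →L[ℤ] E := ⟨G.subtype.toIntLinearMap, continuous_subtype_val⟩
  have hd : DenseRange i := hG.denseRange_val
  have hi : IsUniformInducing i := isUniformEmbedding_subtype_val.isUniformInducing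
  let V := f'.extend i
  have hV (a : G) : V a = f a := f'.extend_eq hd hi a
  refine ⟨⟨(V.toLinearMap.toAddMonoidHom.toRealLinearMap V.continuous).toLinearMap, ?_⟩, hV⟩
  intro e
  change ‖V e‖ = ‖e‖
  refine hd.induction_on e (isClosed_eq (by fun_prop) (by fun_prop)) fun a => ?_
  exact (congrArg norm (hV a)).trans (hf a)

/-- A family of measurable functions that depends additively on `e` and has pointwise norm
`g x * ‖e‖` almost everywhere is the multiple by `g` of a strongly measurable family of linear
isometries. -/
theorem exists_measurable_smul_linearIsometry {E F X : Type*}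
    [NormedAddCommGroup E] [NormedSpace ℝ E] [TopologicalSpace.SeparableSpace E]
    [NormedAddCommGroup F] [NormedSpace ℝ F] [CompleteSpace F]
    [MeasurableSpace X] {σ : Measure X} (S : E → X → F) (hS : ∀ e, StronglyMeasurable (S e))
    (hadd : ∀ a b, ∀ᵐ x ∂σ, S (a + b) x = S a x + S b x)
    {g : X → ℝ} (hg : Measurable g) (hg0 : ∀ x, 0 ≤ g x)
    (hnorm : ∀ e, ∀ᵐ x ∂σ, ‖S e x‖ = g x * ‖e‖) (hne : ¬ ∀ᵐ x ∂σ, g x = 0) :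
    ∃ h : X → ℝ, Measurable h ∧ ∃ U : X → (E →ₗᵢ[ℝ] F),
      (∀ e : E, StronglyMeasurable fun x => U x e) ∧
      ∀ e : E, ∀ᵐ x ∂σ, S e x = h x • U x e := by
  classical
  let G : AddSubgroup E := (LinearMap.range
    (Finsupp.linearCombination ℤ (TopologicalSpace.denseSeq E))).toAddSubgroup
  have hGc : Countable G := (Set.countable_range
    (Finsupp.linearCombination ℤ (TopologicalSpace.denseSeq E))).to_subtype
  have hGd : Dense (G : Set E) := (TopologicalSpace.denseRange_denseSeq E).mono (by
    rintro _ ⟨n, rfl⟩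
    exact ⟨Finsupp.single n 1, by simp⟩)
  have hgood : ∀ᵐ x ∂σ, ∀ a : G, ‖S a x‖ = g x * ‖(a : E)‖ ∧
      ∀ b : G, S (a + b) x = S a x + S b x := by
    rw [ae_all_iff]
    intro a
    filter_upwards [hnorm a, ae_all_iff.2 fun b : G => hadd a b] with x h1 h2
    exact ⟨h1, h2⟩
  obtain ⟨B, hBae, hBm, hB⟩ := hgood.exists_measurable_mem
  let A : Set X := B ∩ {x | g x ≠ 0}
  have hAm : MeasurableSet A := hBm.inter (hg (measurableSet_singleton 0)).compl
  have hext (x : X) (hx : x ∈ A) :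
      ∃ V : E →ₗᵢ[ℝ] F, ∀ a : G, V a = (g x)⁻¹ • S a x := by
    obtain ⟨hxB, hx0⟩ := hx
    refine G.exists_linearIsometry_extension hGd
      (AddMonoidHom.mk' (fun a => (g x)⁻¹ • S a x) fun a b => ?_) fun a => ?_
    · rw [AddSubgroup.coe_add, (hB x hxB a).2 b, smul_add]
    · simp only [AddMonoidHom.mk'_apply]
      rw [norm_smul, (hB x hxB a).1, norm_inv, Real.norm_of_nonneg (hg0 x),
        inv_mul_cancel_left₀ hx0, AddSubgroup.coe_norm]
  obtain ⟨x₀, hx₀⟩ : A.Nonempty := by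
    by_contra hA
    rw [Set.not_nonempty_iff_eq_empty] at hA
    refine hne ?_
    filter_upwards [hBae] with x hx
    by_contra h0
    exact Set.notMem_empty x (hA ▸ ⟨hx, h0⟩)
  obtain ⟨U₀, -⟩ := hext x₀ hx₀
  choose V hV using hext
  let U : X → (E →ₗᵢ[ℝ] F) := fun x => if hx : x ∈ A then V x hx else U₀
  have hUA (x : X) (hx : x ∈ A) (a : G) : U x a = (g x)⁻¹ • S a x := by
    simp only [U, dif_pos hx, hV]
  refine ⟨g, hg, U, fun e => ?_, fun e => ?_⟩
  · obtain ⟨u, huG, hu⟩ := mem_closure_iff_seq_limit.1 (hGd e)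
    refine stronglyMeasurable_of_tendsto atTop (f := fun n x => U x (u n)) (fun n => ?_)
      (tendsto_pi_nhds.2 fun x => ((U x).continuous.tendsto e).comp hu)
    have hpw : (fun x => U x (u n)) =
        A.piecewise (fun x => (g x)⁻¹ • S (u n) x) fun _ => U₀ (u n) := by
      funext x
      by_cases hx : x ∈ A
      · simpa [hx] using hUA x hx ⟨u n, huG n⟩
      · simp [hx, U]
    rw [hpw]
    exact (hg.inv.stronglyMeasurable.smul (hS _)).piecewise hAm stronglyMeasurable_const
  · obtain ⟨u, huG, hu⟩ := mem_closure_iff_seq_limit.1 (hGd e)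
    filter_upwards [hBae, hnorm e, ae_all_iff.2 fun n => hadd (e - u n) (u n),
      ae_all_iff.2 fun n => hnorm (e - u n)] with x hxB hxe hxadd hxn
    by_cases h0 : g x = 0
    · rw [h0, zero_mul, norm_eq_zero] at hxe
      rw [hxe, h0, zero_smul]
    have hx : x ∈ A := ⟨hxB, h0⟩
    have hSu : Tendsto (fun n => S (u n) x) atTop (𝓝 (g x • U x e)) := by
      refine ((((U x).continuous.tendsto e).comp hu).const_smul (g x)).congr fun n => ?_
      have := hUA x hx ⟨u n, huG n⟩
      simp only [Function.comp_apply]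
      rw [this, smul_inv_smul₀ h0]
    refine tendsto_nhds_unique (tendsto_iff_norm_sub_tendsto_zero.2 ?_) hSu
    have hlim : Tendsto (fun n => g x * ‖u n - e‖) atTop (𝓝 0) := by
      simpa using (tendsto_iff_norm_sub_tendsto_zero.1 hu).const_mul (g x)
    refine hlim.congr fun n => ?_
    have hn := hxadd n
    rw [sub_add_cancel] at hn
    rw [norm_sub_rev (u n) e, ← hxn n, norm_sub_rev, hn, add_sub_cancel_right]


/-- A linear isometry into a Lebesgue–Bochner space with `1 < p < ∞` is a multiple of a strongly
measurable family of linear isometries, if its domain contains a unit vector `u` such that every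
unit vector is aligned with `u` or with `-u`. -/
theorem exists_eq_smul_linearIsometry_of_norm_add_eq_two {E F X : Type*}
    [NormedAddCommGroup E] [NormedSpace ℝ E] [TopologicalSpace.SeparableSpace E]
    [NormedAddCommGroup F] [NormedSpace ℝ F] [CompleteSpace F]
    [MeasurableSpace X] {σ : Measure X}
    {p : ℝ} (hp : 1 < p) [Fact (1 ≤ ENNReal.ofReal p)]
    (u : E) (hu : ∀ f : E, ‖f‖ = 1 → ‖u‖ = 1 ∧ (‖u + f‖ = 2 ∨ ‖u - f‖ = 2))
    (T : E →ₗᵢ[ℝ] Lp F (ENNReal.ofReal p) σ) :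
    ∃ h : X → ℝ, Measurable h ∧
      ∃ U : X → (E →ₗᵢ[ℝ] F),
        (∀ e : E, StronglyMeasurable fun x => U x e) ∧
        ∀ e : E, ∀ᵐ x ∂σ, T e x = h x • U x e := by
  have hT1 (f : E) (hf : ‖f‖ = 1) : ∀ᵐ x ∂σ, ‖T u x‖ = ‖T f x‖ := by
    obtain ⟨hone, h⟩ := hu f hf
    rcases h with h | h
    · refine ae_norm_eq_of_norm_add_eq_two hp _ _ ?_ ?_ ?_
      · rw [T.norm_map, hone]
      · rw [T.norm_map, hf]
      · rw [← T.map_add, T.norm_map]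
        exact h
    · have := ae_norm_eq_of_norm_add_eq_two hp (T u) (-T f) (by rw [T.norm_map, hone])
        (by rw [norm_neg, T.norm_map, hf]) (by
          rw [← sub_eq_add_neg, ← T.map_sub, T.norm_map]
          exact h)
      filter_upwards [this, Lp.coeFn_neg (T f)] with x hx hx'
      rw [hx, hx', Pi.neg_apply, norm_neg]
  have hnorm (e : E) : ∀ᵐ x ∂σ, ‖T e x‖ = ‖T u x‖ * ‖e‖ := by
    rcases eq_or_ne e 0 with rfl | he
    · rw [T.map_zero]
      filter_upwards [Lp.coeFn_zero F (ENNReal.ofReal p) σ] with x hx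
      rw [hx, Pi.zero_apply, norm_zero, norm_zero, mul_zero]
    · have he' : ‖e‖ ≠ 0 := norm_ne_zero_iff.2 he
      have hsmul := Lp.coeFn_smul (‖e‖⁻¹) (T e)
      rw [← T.map_smul] at hsmul
      filter_upwards [hT1 (‖e‖⁻¹ • e) (norm_smul_inv_norm (𝕜 := ℝ) he), hsmul] with x hx hx'
      rw [hx, hx', Pi.smul_apply, norm_smul, norm_inv, norm_norm, mul_comm,
        mul_inv_cancel_left₀ he']
  rcases subsingleton_or_nontrivial E with hEs | hEn
  · refine ⟨0, measurable_zero, fun _ => ⟨0, fun e => ?_⟩, fun e => ?_, fun e => ?_⟩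
    · simp [Subsingleton.elim e 0]
    · exact stronglyMeasurable_const
    · rw [Subsingleton.elim e 0, T.map_zero]
      filter_upwards [Lp.coeFn_zero F (ENNReal.ofReal p) σ] with x hx
      rw [hx, Pi.zero_apply, Pi.zero_apply, zero_smul]
  refine exists_measurable_smul_linearIsometry (fun e => T e)
    (fun e => Lp.stronglyMeasurable (T e)) (fun a b => ?_)
    (Lp.stronglyMeasurable (T u)).norm.measurable (fun _ => norm_nonneg _) hnorm ?_
  · rw [T.map_add]
    exact Lp.coeFn_add _ _
  · intro h0
    obtain ⟨e, he⟩ := exists_ne (0 : E)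
    refine he (T.injective ?_)
    rw [T.map_zero, Lp.eq_zero_iff_ae_eq_zero]
    filter_upwards [h0, hnorm e] with x hx hx'
    rwa [hx, zero_mul, norm_eq_zero] at hx'

/-- Theorem 1(ii) for a closed subspace `E` of `C(K)` containing `1`: every linear
isometry `T : E → L_p(X; F)` with `p > 1` has the form `Te(x) = h(x) U(x) e`
for a measurable `h : X → ℝ` and a strongly measurable family `U` of linear
isometries from `E` into `F`. -/
theorem isometry_subspace_C_K_into_Lp_form
    {K : Type*} [MetricSpace K] [CompactSpace K]
    {F : Type*} [NormedAddCommGroup F] [NormedSpace ℝ F] [CompleteSpace F]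
    {X : Type*} [MeasurableSpace X] (σ : Measure X) [IsFiniteMeasure σ]
    {p : ℝ} (hp : 1 < p) [Fact (1 ≤ ENNReal.ofReal p)]
    (E : Subspace ℝ C(K, ℝ)) (hE : IsClosed (E : Set C(K, ℝ)))
    (h1 : (1 : C(K, ℝ)) ∈ E)
    (T : E →ₗᵢ[ℝ] Lp F (ENNReal.ofReal p) σ) :
    ∃ h : X → ℝ, Measurable h ∧
      ∃ U : X → (E →ₗᵢ[ℝ] F),
        (∀ e : E, StronglyMeasurable fun x => U x e) ∧
        ∀ e : E, ∀ᵐ x ∂σ, T e x = h x • U x e := by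
  refine exists_eq_smul_linearIsometry_of_norm_add_eq_two hp (⟨1, h1⟩ : E) (fun f hf => ⟨?_, ?_⟩) T
  · have hK : Nonempty K := by
      by_contra h
      rw [not_nonempty_iff] at h
      have hf0 : (f : C(K, ℝ)) = 0 := Subsingleton.elim _ _
      have hf1 : ‖(f : C(K, ℝ))‖ = 1 := hf
      rw [hf0, norm_zero] at hf1
      exact zero_ne_one hf1
    exact norm_one (α := C(K, ℝ))
  · exact norm_one_add_eq_two_or_norm_one_sub_eq_two (f : C(K, ℝ)) hf
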